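/- Let A be a nicely essential subring of a ring S. If A is prime then S is prime, and if A is semiprime then S is semiprime. If moreover A is semiprime (resp. prime) and left Goldie, then S is left Goldie. -/

import Mathlib

universe u v

section ModuleDefs

variable {R : Type u} [Ring R] {M : Type v} [AddCommGroup M] [Module R M]

/-- `N` is an essential submodule of `M`: it meets every nonzero submodule nontrivially. -/
def IsEssentialSubmodule (N : Submodule R M) : Prop :=
  ∀ K : Submodule R M, K ≠ ⊥ → N ⊓ K ≠ ⊥

/-- `N` is an essential submodule of `P`: `N ≤ P` and `N` meets every nonzero submodule
contained in `P` nontrivially. -/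
def IsEssentialIn (N P : Submodule R M) : Prop :=
  N ≤ P ∧ ∀ K : Submodule R M, K ≤ P → K ≠ ⊥ → N ⊓ K ≠ ⊥

/-- `U` is a uniform submodule: `U ≠ ⊥` and any two nonzero submodules contained in `U`
intersect nontrivially. -/
def IsUniformSubmodule (U : Submodule R M) : Prop :=
  U ≠ ⊥ ∧ ∀ K L : Submodule R M, K ≤ U → L ≤ U → K ≠ ⊥ → L ≠ ⊥ → K ⊓ L ≠ ⊥

end ModuleDefs

/-- The uniform (Goldie) dimension of a module: the supremum of the cardinals `#ι` over all
independent families `(f i)_{i : ι}` of nonzero submodules. -/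
noncomputable def udim (R : Type u) (M : Type v) [Ring R] [AddCommGroup M] [Module R M] :
    Cardinal.{v} :=
  sSup { c : Cardinal.{v} | ∃ (ι : Type v) (f : ι → Submodule R M),
    iSupIndep f ∧ (∀ i, f i ≠ ⊥) ∧ c = Cardinal.mk ι }

/-- A ring has enough uniform left ideals if every nonzero left ideal contains a uniform
left ideal. -/
def HasEnoughUniformLeftIdeals (T : Type u) [Ring T] : Prop :=
  ∀ L : Ideal T, L ≠ ⊥ → ∃ U : Ideal T, U ≤ L ∧ IsUniformSubmodule U

/-- The left annihilator of an element, as a left ideal. -/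
def lAnn (T : Type u) [Ring T] (x : T) : Ideal T where
  carrier := {t | t * x = 0}
  add_mem' := by
    intro a b ha hb
    simp only [Set.mem_setOf_eq] at *
    rw [add_mul, ha, hb, add_zero]
  zero_mem' := by simp
  smul_mem' := by
    intro c t ht
    simp only [smul_eq_mul, Set.mem_setOf_eq] at *
    rw [mul_assoc, ht, mul_zero]

/-- The left singular ideal of a ring, as a set: the elements whose left annihilator is an
essential left ideal. -/
def singSet (T : Type u) [Ring T] : Set T := {x | IsEssentialSubmodule (lAnn T x)}

/-- The left annihilator of a set, as a left ideal. -/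
def lAnnSet (T : Type u) [Ring T] (U : Set T) : Ideal T where
  carrier := {t | ∀ u ∈ U, t * u = 0}
  add_mem' := by
    intro a b ha hb u hu
    rw [add_mul, ha u hu, hb u hu, add_zero]
  zero_mem' := by intro u hu; simp
  smul_mem' := by
    intro c t ht u hu
    simp only [smul_eq_mul]
    rw [mul_assoc, ht u hu, mul_zero]

/-- The ascending chain condition on left annihilators. -/
def ACCLeftAnnihilators (T : Type u) [Ring T] : Prop :=
  ∀ f : ℕ → Ideal T, (∀ n, ∃ U : Set T, f n = lAnnSet T U) → Monotone f →
    ∃ n, ∀ m, n ≤ m → f m = f n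

/-- A ring is left Goldie if it has finite left uniform dimension (no infinite independent
family of nonzero left ideals) and the ACC on left annihilators. -/
def IsLeftGoldie (T : Type u) [Ring T] : Prop :=
  (¬ ∃ f : ℕ → Ideal T, iSupIndep f ∧ ∀ n, f n ≠ ⊥) ∧ ACCLeftAnnihilators T

/-- A ring is prime: `I·J = 0` forces `I = 0` or `J = 0` for two-sided ideals. -/
def IsPrimeRing (T : Type u) [Ring T] : Prop :=
  ∀ I J : TwoSidedIdeal T, (∀ x ∈ I, ∀ y ∈ J, x * y = 0) → I = ⊥ ∨ J = ⊥

/-- A ring is semiprime: `I·I = 0` forces `I = 0` for two-sided ideals. -/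
def IsSemiprimeRing (T : Type u) [Ring T] : Prop :=
  ∀ I : TwoSidedIdeal T, (∀ x ∈ I, ∀ y ∈ I, x * y = 0) → I = ⊥

section Subring

variable {S : Type u} [Ring S]

/-- A subring `A` of `S`, viewed as a left `A`-submodule of `S`. -/
def Subring.selfSubmodule (A : Subring S) : Submodule A S where
  carrier := A
  add_mem' := by intro a b ha hb; exact add_mem ha hb
  zero_mem' := zero_mem _
  smul_mem' := by intro a x hx; exact mul_mem a.2 hx

/-- `A` is a nicely essential subring of `S`. -/
def Subring.NicelyEssential (A : Subring S) : Prop :=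
  ∀ E : Finset S, (∀ x ∈ E, x ≠ 0) → ∃ a ∈ A, ∀ x ∈ E, a * x ∈ A ∧ a * x ≠ 0

/-- `A` is a strongly nicely essential subring of `S`. -/
def Subring.StronglyNicelyEssential (A : Subring S) : Prop :=
  A.NicelyEssential ∧ ∀ x : S, ∃ c ∈ A, c * x ∈ A ∧ ∀ b ∈ A, b * c = 0 → b = 0

/-- The left annihilator in the subring `A` of an element `x` of the ambient ring,
as a left ideal of `A`. -/
def Subring.lAnnIn (A : Subring S) (x : S) : Ideal A where
  carrier := {b | (b : S) * x = 0}
  add_mem' := by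
    intro a b ha hb
    simp only [Set.mem_setOf_eq] at *
    push_cast
    rw [add_mul, ha, hb, add_zero]
  zero_mem' := by simp
  smul_mem' := by
    intro c t ht
    simp only [smul_eq_mul, Set.mem_setOf_eq] at *
    push_cast
    rw [mul_assoc, ht, mul_zero]

end Subring

section Module

variable {R : Type u} [Ring R] {M : Type v} [AddCommGroup M] [Module R M]

theorem isEssentialSubmodule_iff {N : Submodule R M} :
    IsEssentialSubmodule N ↔ ∀ x : M, x ≠ 0 → ∃ r : R, r • x ∈ N ∧ r • x ≠ 0 := by
  constructor
  · intro h x hx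
    obtain ⟨y, ⟨hyN, hyx⟩, hy⟩ := (Submodule.ne_bot_iff _).1
      (h (R ∙ x) (by rwa [Ne, Submodule.span_singleton_eq_bot]))
    obtain ⟨r, rfl⟩ := Submodule.mem_span_singleton.1 hyx
    exact ⟨r, hyN, hy⟩
  · intro h K hK
    obtain ⟨x, hxK, hx⟩ := (Submodule.ne_bot_iff _).1 hK
    obtain ⟨r, hrN, hr⟩ := h x hx
    exact (Submodule.ne_bot_iff _).2 ⟨r • x, ⟨hrN, K.smul_mem r hxK⟩, hr⟩

theorem IsEssentialSubmodule.mono {N P : Submodule R M} (hN : IsEssentialSubmodule N)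
    (h : N ≤ P) : IsEssentialSubmodule P := fun K hK hb =>
  hN K hK (le_bot_iff.1 (hb ▸ inf_le_inf_right K h))

/-- If every nonzero element of `P` has a nonzero multiple in `N`, then for `s ∈ P` the
left ideal `{t | t • s ∈ N}` is essential. -/
theorem isEssentialSubmodule_comap_toSpanSingleton {N P : Submodule R M}
    (h : ∀ x ∈ P, x ≠ 0 → ∃ r : R, r • x ∈ N ∧ r • x ≠ 0) {s : M} (hs : s ∈ P) :
    IsEssentialSubmodule (N.comap (LinearMap.toSpanSingleton R M s)) := by
  rw [isEssentialSubmodule_iff]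
  intro t ht
  by_cases hts : t • s = 0
  · exact ⟨1, by simp [hts], by simpa using ht⟩
  · obtain ⟨r, hrN, hr⟩ := h _ (P.smul_mem t hs) hts
    refine ⟨r, by simpa [mul_smul] using hrN, fun h0 => hr ?_⟩
    rw [← mul_smul, ← smul_eq_mul, h0, zero_smul]

/-- A sequence of submodules, each disjoint from a submodule of an increasing chain
that contains all the earlier ones, is independent. -/
theorem iSupIndep_of_disjoint_chain {F K : ℕ → Submodule R M} (hF : Monotone F)
    (hKF : ∀ n, K n ≤ F (n + 1)) (hd : ∀ n, Disjoint (K n) (F n)) : iSupIndep K := by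
  rw [iSupIndep_iff_finsetSum_eq_zero_imp_eq_zero]
  intro s v
  induction s using Finset.induction_on_max with
  | empty => simp
  | insert a s hmax ih =>
    intro hv hsum
    have ha : a ∉ s := fun h => (hmax a h).false
    rw [Finset.sum_insert ha] at hsum
    have hmem : ∑ i ∈ s, v i ∈ F a := Submodule.sum_mem _ fun i hi =>
      hF (hmax i hi) (hKF i (hv i (Finset.mem_insert_of_mem hi)))
    have hva : v a = 0 := by
      refine Submodule.disjoint_def.1 (hd a) _ (hv a (Finset.mem_insert_self a s)) ?_
      rw [eq_neg_of_add_eq_zero_left hsum]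
      exact neg_mem hmem
    rw [hva, zero_add] at hsum
    have hs := ih (fun i hi => hv i (Finset.mem_insert_of_mem hi)) hsum
    intro i hi
    rcases Finset.mem_insert.1 hi with rfl | hi
    · exact hva
    · exact hs i hi

end Module

section Ring

variable {T : Type u} [Ring T]

theorem mem_lAnn {x t : T} : t ∈ lAnn T x ↔ t * x = 0 := Iff.rfl

theorem mem_lAnnSet {U : Set T} {t : T} : t ∈ lAnnSet T U ↔ ∀ u ∈ U, t * u = 0 := Iff.rfl

theorem lAnn_eq_lAnnSet_singleton (x : T) : lAnn T x = lAnnSet T {x} := by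
  ext t
  simp [mem_lAnn, mem_lAnnSet]

theorem lAnn_le_lAnn_mul (x y : T) : lAnn T x ≤ lAnn T (x * y) := fun t ht => by
  rw [mem_lAnn] at *
  rw [← mul_assoc, ht, zero_mul]

theorem mul_mem_singSet_right {x : T} (hx : x ∈ singSet T) (y : T) : x * y ∈ singSet T :=
  IsEssentialSubmodule.mono hx (lAnn_le_lAnn_mul x y)

theorem mul_mem_singSet_left {x : T} (hx : x ∈ singSet T) (y : T) : y * x ∈ singSet T := by
  refine IsEssentialSubmodule.mono (isEssentialSubmodule_comap_toSpanSingleton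
    (fun z _ hz => isEssentialSubmodule_iff.1 hx z hz) (Submodule.mem_top (x := y))) ?_
  intro t ht
  have ht' : t * y * x = 0 := ht
  rwa [mul_assoc] at ht'

/-- The elements annihilated on the left by `x T`, as a two-sided ideal. -/
def rAnnTwoSided (x : T) : TwoSidedIdeal T :=
  TwoSidedIdeal.mk' {t | ∀ a, x * a * t = 0}
    (by simp)
    (fun hs ht a => by rw [mul_add, hs a, ht a, add_zero])
    (fun ht a => by rw [mul_neg, ht a, neg_zero])
    (fun {r t} ht a => by rw [← mul_assoc, mul_assoc x, ht])
    (fun {t r} ht a => by rw [← mul_assoc, ht a, zero_mul])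

theorem mem_rAnnTwoSided {x t : T} : t ∈ rAnnTwoSided x ↔ ∀ a, x * a * t = 0 :=
  TwoSidedIdeal.mem_mk' ..

/-- The left annihilator of a two-sided ideal, as a two-sided ideal. -/
def TwoSidedIdeal.lAnn (J : TwoSidedIdeal T) : TwoSidedIdeal T :=
  TwoSidedIdeal.mk' {s | ∀ t ∈ J, s * t = 0}
    (by simp)
    (fun hs ht a ha => by rw [add_mul, hs a ha, ht a ha, add_zero])
    (fun ht a ha => by rw [neg_mul, ht a ha, neg_zero])
    (fun {r t} ht a ha => by rw [mul_assoc, ht a ha, mul_zero])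
    (fun {t r} ht a ha => by rw [mul_assoc, ht _ (J.mul_mem_left r a ha)])

theorem TwoSidedIdeal.mem_lAnn {J : TwoSidedIdeal T} {s : T} :
    s ∈ J.lAnn ↔ ∀ t ∈ J, s * t = 0 :=
  TwoSidedIdeal.mem_mk' ..

theorem mem_lAnn_rAnnTwoSided (x : T) : x ∈ (rAnnTwoSided x).lAnn :=
  TwoSidedIdeal.mem_lAnn.2 fun t ht => by simpa using mem_rAnnTwoSided.1 ht 1

theorem IsPrimeRing.eq_zero_or_eq_zero (hT : IsPrimeRing T) {x y : T}
    (h : ∀ a, x * a * y = 0) : x = 0 ∨ y = 0 := by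
  refine (hT (rAnnTwoSided x).lAnn (rAnnTwoSided x)
    fun s hs t ht => TwoSidedIdeal.mem_lAnn.1 hs t ht).imp (fun hI => ?_) (fun hJ => ?_)
  · simpa [hI, TwoSidedIdeal.mem_bot] using mem_lAnn_rAnnTwoSided x
  · simpa [hJ, TwoSidedIdeal.mem_bot] using mem_rAnnTwoSided.2 h

theorem IsSemiprimeRing.eq_zero (hT : IsSemiprimeRing T) {x : T}
    (h : ∀ a, x * a * x = 0) : x = 0 := by
  have hI := hT ((rAnnTwoSided x).lAnn ⊓ rAnnTwoSided x) fun s hs t ht =>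
    TwoSidedIdeal.mem_lAnn.1 ((TwoSidedIdeal.mem_inf T).1 hs).1 t ((TwoSidedIdeal.mem_inf T).1 ht).2
  have hx : x ∈ (rAnnTwoSided x).lAnn ⊓ rAnnTwoSided x :=
    (TwoSidedIdeal.mem_inf T).2 ⟨mem_lAnn_rAnnTwoSided x, mem_rAnnTwoSided.2 h⟩
  simpa [hI, TwoSidedIdeal.mem_bot] using hx

theorem IsPrimeRing.isSemiprimeRing (hT : IsPrimeRing T) : IsSemiprimeRing T :=
  fun I h => or_self_iff.1 (hT I I h)

theorem isPrimeRing_of_forall (h : ∀ x y : T, (∀ a, x * a * y = 0) → x = 0 ∨ y = 0) :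
    IsPrimeRing T := by
  intro I J hIJ
  by_contra! hne
  obtain ⟨⟨x, hxI, hx⟩, y, hyJ, hy⟩ :
      (∃ x ∈ I, x ≠ 0) ∧ ∃ y ∈ J, y ≠ 0 := by
    constructor <;> by_contra! h0
    · exact hne.1 (le_bot_iff.1 fun x hx => (TwoSidedIdeal.mem_bot _).2 (h0 x hx))
    · exact hne.2 (le_bot_iff.1 fun x hx => (TwoSidedIdeal.mem_bot _).2 (h0 x hx))
  exact (h x y fun a => hIJ _ (I.mul_mem_right x a hxI) y hyJ).elim hx hy

theorem isSemiprimeRing_of_forall (h : ∀ x : T, (∀ a, x * a * x = 0) → x = 0) :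
    IsSemiprimeRing T := fun I hI =>
  le_bot_iff.1 fun x hx => (TwoSidedIdeal.mem_bot _).2
    (h x fun a => hI _ (I.mul_mem_right x a hx) x hx)

/-- Under the ACC on left annihilators, every nonempty set of elements has a member whose
left annihilator is maximal. -/
theorem ACCLeftAnnihilators.exists_maximal_lAnn (hT : ACCLeftAnnihilators T) {Z : Set T}
    (hZ : Z.Nonempty) : ∃ z ∈ Z, ∀ y ∈ Z, ¬ lAnn T z < lAnn T y := by
  have hwf : WellFoundedGT {L : Ideal T // ∃ U : Set T, L = lAnnSet T U} := by
    rw [wellFoundedGT_iff_monotone_chain_condition]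
    intro a
    obtain ⟨n, hn⟩ := hT (fun n => (a n).1) (fun n => (a n).2) fun i j hij => a.monotone hij
    exact ⟨n, fun m hm => Subtype.ext (hn m hm).symm⟩
  let φ : T → {L : Ideal T // ∃ U : Set T, L = lAnnSet T U} :=
    fun z => ⟨lAnn T z, {z}, lAnn_eq_lAnnSet_singleton z⟩
  obtain ⟨_, ⟨z, hz, rfl⟩, hmax⟩ := hwf.wf.has_min (φ '' Z) (hZ.image φ)
  exact ⟨z, hz, fun y hy hlt => hmax (φ y) ⟨y, hy, rfl⟩ hlt⟩

/-- A semiprime ring with the ACC on left annihilators is left nonsingular. -/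
theorem IsSemiprimeRing.eq_zero_of_mem_singSet (hT : IsSemiprimeRing T)
    (hacc : ACCLeftAnnihilators T) {x : T} (hx : x ∈ singSet T) : x = 0 := by
  by_contra hx0
  obtain ⟨z, ⟨hz, hz0⟩, hmax⟩ := hacc.exists_maximal_lAnn (Z := {z | z ∈ singSet T ∧ z ≠ 0})
    ⟨x, hx, hx0⟩
  refine hz0 (hT.eq_zero fun a => ?_)
  by_contra hzaz
  obtain ⟨b, hb, hb0⟩ := isEssentialSubmodule_iff.1 (mul_mem_singSet_left hz a) z hz0
  rw [mem_lAnn, smul_eq_mul, mul_assoc] at hb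
  rw [smul_eq_mul] at hb0
  refine hmax (z * a * z) ⟨mul_mem_singSet_left hz _, hzaz⟩ (lt_of_le_of_ne ?_ fun he => ?_)
  · rw [mul_assoc]
    exact lAnn_le_lAnn_mul z _
  · refine hb0 (mem_lAnn.1 (he ▸ ?_))
    rw [mem_lAnn, mul_assoc z, hb]

/-- In a left nonsingular ring, a left annihilator properly contained in a left ideal `L`
is disjoint from some nonzero left ideal contained in `L`. -/
theorem exists_disjoint_lAnnSet_of_lt (hT : ∀ x ∈ singSet T, x = 0) {U : Set T} {L : Ideal T}
    (h : lAnnSet T U < L) : ∃ K : Ideal T, K ≠ ⊥ ∧ K ≤ L ∧ Disjoint K (lAnnSet T U) := by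
  obtain ⟨s, hsL, hs⟩ := SetLike.exists_of_lt h
  by_contra! hK
  have hess : ∀ x ∈ L, x ≠ 0 → ∃ r : T, r • x ∈ lAnnSet T U ∧ r • x ≠ 0 := by
    intro x hxL hx
    have hd := hK (T ∙ x) (by rwa [Ne, Submodule.span_singleton_eq_bot])
      (by rwa [Submodule.span_singleton_le_iff_mem])
    rw [Submodule.disjoint_def] at hd
    push Not at hd
    obtain ⟨y, hyx, hyU, hy⟩ := hd
    obtain ⟨r, rfl⟩ := Submodule.mem_span_singleton.1 hyx
    exact ⟨r, hyU, hy⟩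
  refine hs fun u hu => hT _ ?_
  refine (isEssentialSubmodule_comap_toSpanSingleton hess hsL).mono fun t ht => ?_
  have htu : t * s * u = 0 := ht u hu
  rwa [mul_assoc] at htu

/-- A left nonsingular ring of finite left uniform dimension is left Goldie. -/
theorem isLeftGoldie_of_nonsingular (hT : ∀ x ∈ singSet T, x = 0)
    (hfin : ¬ ∃ f : ℕ → Ideal T, iSupIndep f ∧ ∀ n, f n ≠ ⊥) : IsLeftGoldie T := by
  refine ⟨hfin, fun f hf hmono => ?_⟩
  by_contra! hne
  choose g hg hgne using hne
  have hlt : ∀ n, f n < f (g n) := fun n => lt_of_le_of_ne (hmono (hg n)) (hgne n).symm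
  have hK : ∀ n, ∃ K : Ideal T, K ≠ ⊥ ∧ K ≤ f (g n) ∧ Disjoint K (f n) := by
    intro n
    obtain ⟨U, hU⟩ := hf n
    have h := hlt n
    rw [hU] at h ⊢
    exact exists_disjoint_lAnnSet_of_lt hT h
  choose K hK0 hKle hKd using hK
  have hsucc : ∀ n, g^[n + 1] 0 = g (g^[n] 0) := fun n => Function.iterate_succ_apply' g n 0
  refine hfin ⟨fun n => K (g^[n] 0), ?_, fun n => hK0 _⟩
  refine iSupIndep_of_disjoint_chain (F := fun n => f (g^[n] 0)) ?_ (fun n => ?_)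
    (fun n => hKd _)
  · exact hmono.comp (monotone_nat_of_le_succ fun n => by rw [hsucc]; exact hg _)
  · simp only [hsucc]
    exact hKle _

end Ring

namespace Subring.NicelyEssential

variable {S : Type u} [Ring S] {A : Subring S}

theorem exists_pair (hA : A.NicelyEssential) {x y : S} (hx : x ≠ 0) (hy : y ≠ 0) :
    ∃ a, (a * x ∈ A ∧ a * x ≠ 0) ∧ a * y ∈ A ∧ a * y ≠ 0 := by
  classical
  obtain ⟨a, -, h⟩ := hA {x, y} (by simp [hx, hy])
  exact ⟨a, h x (by simp), h y (by simp)⟩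

theorem mul_mul_eq_zero {x y a : S} (h : ∀ s, x * s * y = 0)
    (hx : a * x ∈ A) (hy : a * y ∈ A) (b : A) :
    (⟨a * x, hx⟩ : A) * b * ⟨a * y, hy⟩ = 0 := by
  ext
  have : a * x * b * (a * y) = a * (x * (b * a) * y) := by simp only [mul_assoc]
  simp [this, h]

theorem isPrimeRing (hA : A.NicelyEssential) (h : IsPrimeRing A) : IsPrimeRing S := by
  refine isPrimeRing_of_forall fun x y hxy => ?_
  by_contra! hne
  obtain ⟨a, ⟨hx, hx0⟩, hy, hy0⟩ := hA.exists_pair hne.1 hne.2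
  rcases h.eq_zero_or_eq_zero (mul_mul_eq_zero hxy hx hy) with h0 | h0
  · exact hx0 (congrArg Subtype.val h0)
  · exact hy0 (congrArg Subtype.val h0)

theorem isSemiprimeRing (hA : A.NicelyEssential) (h : IsSemiprimeRing A) :
    IsSemiprimeRing S := by
  refine isSemiprimeRing_of_forall fun x hxx => ?_
  by_contra hne
  obtain ⟨a, ⟨hx, hx0⟩, -⟩ := hA.exists_pair hne hne
  exact hx0 (congrArg Subtype.val (h.eq_zero (mul_mul_eq_zero hxx hx hx)))

theorem eq_zero_of_mem_singSet (hA : A.NicelyEssential) (h : ∀ x ∈ singSet A, x = 0)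
    {x : S} (hx : x ∈ singSet S) : x = 0 := by
  by_contra hx0
  obtain ⟨c, ⟨hc, hc0⟩, -⟩ := hA.exists_pair hx0 hx0
  refine hc0 (congrArg Subtype.val (h ⟨c * x, hc⟩ (isEssentialSubmodule_iff.2 fun b hb => ?_)))
  obtain ⟨s, hs, hsb⟩ := isEssentialSubmodule_iff.1 (mul_mem_singSet_left hx c) (b : S)
    (by simpa using hb)
  rw [mem_lAnn, smul_eq_mul] at hs
  rw [smul_eq_mul] at hsb
  obtain ⟨a, ⟨has, -⟩, -, hasb⟩ := hA.exists_pair (left_ne_zero_of_mul hsb) hsb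
  refine ⟨⟨a * s, has⟩, mem_lAnn.2 (Subtype.ext ?_), fun h0 => hasb ?_⟩
  · have : a * s * b * (c * x) = a * (s * b * (c * x)) := by simp only [mul_assoc]
    simp [this, hs]
  · simpa [mul_assoc] using congrArg Subtype.val h0

theorem comap_subtype_ne_bot (hA : A.NicelyEssential) {L : Ideal S} (hL : L ≠ ⊥) :
    L.comap A.subtype ≠ ⊥ := by
  obtain ⟨x, hxL, hx⟩ := (Submodule.ne_bot_iff _).1 hL
  obtain ⟨a, ⟨hax, hax0⟩, -⟩ := hA.exists_pair hx hx
  refine (Submodule.ne_bot_iff _).2 ⟨⟨a * x, hax⟩, L.mul_mem_left a hxL, fun h0 => hax0 ?_⟩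
  exact congrArg Subtype.val h0

theorem isLeftGoldie (hA : A.NicelyEssential) (h : IsSemiprimeRing A) (hG : IsLeftGoldie A) :
    IsLeftGoldie S := by
  refine isLeftGoldie_of_nonsingular
    (fun x => hA.eq_zero_of_mem_singSet fun y => h.eq_zero_of_mem_singSet hG.2) ?_
  rintro ⟨f, hf, hf0⟩
  refine hG.1 ⟨fun n => (f n).comap A.subtype, ?_, fun n => hA.comap_subtype_ne_bot (hf0 n)⟩
  rw [iSupIndep_iff_finsetSum_eq_zero_imp_eq_zero] at hf ⊢
  intro s v hv hsum i hi
  exact Subtype.ext (hf s (fun i => (v i : S)) hv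
    (by exact_mod_cast congrArg Subtype.val hsum) i hi)

end Subring.NicelyEssential

/-- Let `A` be a nicely essential subring of `S`. If `A` is prime (resp.
semiprime) then so is `S`; if moreover `A` is semiprime (resp. prime) and left Goldie,
then `S` is left Goldie. -/
theorem stmt_7 {S : Type u} [Ring S] (A : Subring S) (hA : A.NicelyEssential) :
    (IsPrimeRing ↥A → IsPrimeRing S) ∧
    (IsSemiprimeRing ↥A → IsSemiprimeRing S) ∧
    (IsSemiprimeRing ↥A → IsLeftGoldie ↥A → IsLeftGoldie S) ∧
    (IsPrimeRing ↥A → IsLeftGoldie ↥A → IsLeftGoldie S) := by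
  exact ⟨hA.isPrimeRing, hA.isSemiprimeRing, hA.isLeftGoldie,
    fun h => hA.isLeftGoldie h.isSemiprimeRing⟩
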